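/- Let q ≥ 1, n ≥ 1 a natural number, κ ∈ ℝ, Σ a symmetric positive-definite real q×q matrix, and γ, x̄ ∈ ℝ^q. Let π(μ) = (2π)^(−q/2)·det(Σ/n)^(−1/2)·exp(−(n/2)(x̄−μ)ᵀ Σ⁻¹ (x̄−μ)) be the density of MVN(x̄, Σ/n), and let φ(μ) = C·exp(−(n^κ/2)(μ−γ)ᵀ Σ⁻¹ (μ−γ)) with C > 0 such that ∫_{ℝ^q} φ·π = 1. Then the information gain Δ = h(π) − h^φ(π) equals (q/2)·n^κ/(n^κ + n) − (1/2)·(γ − x̄)ᵀ Σ⁻¹ (γ − x̄)·(n^(κ+1/2)/(n^κ + n))². -/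

import Mathlib

open MeasureTheory Matrix

open ProbabilityTheory in
lemma oneD (a d : ℝ) (ha : 0 < a) :
    Integrable (fun x : ℝ => Real.exp (-(a/2) * (x - d)^2)) ∧
    Integrable (fun x : ℝ => Real.exp (-(a/2) * (x - d)^2) * x^2) ∧
    ∫ x : ℝ, Real.exp (-(a/2) * (x - d)^2) = √(2 * Real.pi / a) ∧
    ∫ x : ℝ, Real.exp (-(a/2) * (x - d)^2) * x^2 = √(2 * Real.pi / a) * (1/a + d^2) := by
  have hv : (⟨1/a, by positivity⟩ : NNReal) ≠ 0 := by
    intro h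
    have h2 : (1/a : ℝ) = 0 := congrArg NNReal.toReal h
    exact (by positivity : (1/a : ℝ) ≠ 0) h2
  set v : NNReal := ⟨1/a, by positivity⟩ with hvdef
  have hvv : (v : ℝ) = 1/a := rfl
  have hs : 0 < √(2 * Real.pi / a) := by positivity
  have hpdf : ∀ x, Real.exp (-(a/2) * (x - d)^2) = √(2 * Real.pi / a) * gaussianPDFReal d v x := by
    intro x
    rw [gaussianPDFReal, hvv, mul_one_div, ← mul_assoc, mul_inv_cancel₀ hs.ne', one_mul]
    congr 1; field_simp
  have hL : MemLp (fun x : ℝ => x) 2 (gaussianReal d v) := memLp_id_gaussianReal 2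
  have hI : Integrable (fun x : ℝ => x^2) (gaussianReal d v) := hL.integrable_sq
  have hI2 : Integrable (fun x : ℝ => gaussianPDFReal d v x * x^2) := by
    rw [gaussianReal_of_var_ne_zero _ hv,
      integrable_withDensity_iff_integrable_smul' (measurable_gaussianPDF _ _)
        (by filter_upwards with x; simp [gaussianPDF])] at hI
    simpa [toReal_gaussianPDF] using hI
  have hE : ∫ x : ℝ, gaussianPDFReal d v x * x^2 = 1/a + d^2 := by
    have h1 := integral_gaussianReal_eq_integral_smul (μ := d) hv (f := fun x : ℝ => x^2)
    simp only [smul_eq_mul] at h1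
    rw [← h1]
    have h2 := variance_eq_sub hL
    rw [variance_fun_id_gaussianReal, integral_id_gaussianReal, hvv] at h2
    simp only [Pi.pow_apply] at h2
    linarith
  simp_rw [hpdf, mul_assoc]
  refine ⟨(integrable_gaussianPDFReal _ _).const_mul _, hI2.const_mul _, ?_, ?_⟩
  · rw [integral_const_mul, integral_gaussianPDFReal_eq_one _ hv, mul_one]
  · rw [integral_const_mul, hE]

lemma stdD (q : ℕ) (a : ℝ) (d : Fin q → ℝ) (ha : 0 < a) :
    Integrable (fun y : Fin q → ℝ => Real.exp (-(a/2) * ((y - d) ⬝ᵥ (y - d)))) ∧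
    Integrable (fun y : Fin q → ℝ => Real.exp (-(a/2) * ((y - d) ⬝ᵥ (y - d))) * (y ⬝ᵥ y)) ∧
    ∫ y : Fin q → ℝ, Real.exp (-(a/2) * ((y - d) ⬝ᵥ (y - d))) = √(2 * Real.pi / a) ^ q ∧
    ∫ y : Fin q → ℝ, Real.exp (-(a/2) * ((y - d) ⬝ᵥ (y - d))) * (y ⬝ᵥ y)
      = √(2 * Real.pi / a) ^ q * (q/a + d ⬝ᵥ d) := by
  have he : ∀ y : Fin q → ℝ, Real.exp (-(a/2) * ((y - d) ⬝ᵥ (y - d)))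
      = ∏ i, Real.exp (-(a/2) * (y i - d i)^2) := by
    intro y
    rw [← Real.exp_sum, ← Finset.mul_sum]
    simp [dotProduct, sq]
  let g : Fin q → Fin q → ℝ → ℝ := fun i j x =>
    Real.exp (-(a/2) * (x - d j)^2) * (if j = i then x^2 else 1)
  have he2 : ∀ y : Fin q → ℝ, Real.exp (-(a/2) * ((y - d) ⬝ᵥ (y - d))) * (y ⬝ᵥ y)
      = ∑ i, ∏ j, g i j (y j) := by
    intro y
    rw [he, dotProduct, Finset.mul_sum]
    refine Finset.sum_congr rfl fun i _ => ?_
    simp only [g, Finset.prod_mul_distrib]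
    simp [sq]
  have hg : ∀ i j, Integrable (g i j) := by
    intro i j
    by_cases h : j = i
    · simpa [g, h] using (oneD a (d i) ha).2.1
    · simpa [g, h] using (oneD a (d j) ha).1
  have hgi : ∀ i, Integrable (fun y : Fin q → ℝ => ∏ j, g i j (y j)) := fun i =>
    Integrable.fintype_prod (hg i)
  simp_rw [he2, he]
  refine ⟨Integrable.fintype_prod (f := fun j (x : ℝ) => Real.exp (-(a/2) * (x - d j)^2))
    fun i => (oneD a (d i) ha).1, integrable_finsetSum _ fun i _ => hgi i, ?_, ?_⟩
  · rw [integral_fintype_prod_volume_eq_prod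
      (fun j (x : ℝ) => Real.exp (-(a/2) * (x - d j)^2))]
    simp only [(oneD a _ ha).2.2.1]
    simp
  · rw [integral_finsetSum _ fun i _ => hgi i]
    have : ∀ i, ∫ y : Fin q → ℝ, ∏ j, g i j (y j) = √(2 * Real.pi / a) ^ q * (1/a + d i * d i) := by
      intro i
      rw [integral_fintype_prod_volume_eq_prod]
      have : ∀ j, ∫ x, g i j x = √(2 * Real.pi / a) * (if j = i then 1/a + d i ^2 else 1) := by
        intro j
        by_cases h : j = i
        · simpa [g, h] using (oneD a (d i) ha).2.2.2
        · simpa [g, h] using (oneD a (d j) ha).2.2.1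
      simp only [this, Finset.prod_mul_distrib]
      simp [sq]
    simp_rw [this]
    rw [← Finset.mul_sum, Finset.sum_add_distrib]
    simp [dotProduct, div_eq_mul_inv]

lemma cov (q : ℕ) (B : Matrix (Fin q) (Fin q) ℝ) (hB : B.det ≠ 0) (F : (Fin q → ℝ) → ℝ)
    (x : Fin q → ℝ) (hF : Integrable F) :
    Integrable (fun μ => F (B *ᵥ (μ - x))) ∧
    ∫ μ, F (B *ᵥ (μ - x)) = |B.det|⁻¹ * ∫ y, F y := by
  have hm := Real.map_matrix_volume_pi_eq_smul_volume_pi hB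
  have hmeas : AEMeasurable (toLin' B) (volume : Measure (Fin q → ℝ)) :=
    (LinearMap.continuous_of_finiteDimensional (toLin' B)).measurable.aemeasurable
  have hF2 : Integrable F (Measure.map (toLin' B) volume) := by
    rw [hm]; exact hF.smul_measure (by simp)
  have h1 : Integrable (fun μ => F (B *ᵥ μ)) := by
    have := hF2.comp_aemeasurable hmeas
    simpa [Function.comp_def] using this
  refine ⟨h1.comp_sub_right x, ?_⟩
  rw [integral_sub_right_eq_self (fun μ => F (B *ᵥ μ)) x]
  have h2 := integral_map hmeas hF2.1
  rw [hm, integral_smul_measure] at h2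
  simp only [toLin'_apply] at h2
  rw [← h2]
  simp [abs_inv]

lemma gaussP (q : ℕ) (P : Matrix (Fin q) (Fin q) ℝ) (hP : P.PosDef) (a : ℝ) (ha : 0 < a)
    (m x : Fin q → ℝ) :
    Integrable (fun μ : Fin q → ℝ => Real.exp (-(a/2) * ((μ - m) ⬝ᵥ P *ᵥ (μ - m)))) ∧
    Integrable (fun μ : Fin q → ℝ => Real.exp (-(a/2) * ((μ - m) ⬝ᵥ P *ᵥ (μ - m)))
      * ((μ - x) ⬝ᵥ P *ᵥ (μ - x))) ∧
    ∫ μ : Fin q → ℝ, Real.exp (-(a/2) * ((μ - m) ⬝ᵥ P *ᵥ (μ - m)))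
      = (√P.det)⁻¹ * √(2 * Real.pi / a) ^ q ∧
    ∫ μ : Fin q → ℝ, Real.exp (-(a/2) * ((μ - m) ⬝ᵥ P *ᵥ (μ - m)))
      * ((μ - x) ⬝ᵥ P *ᵥ (μ - x))
      = (√P.det)⁻¹ * √(2 * Real.pi / a) ^ q * (q/a + (m - x) ⬝ᵥ P *ᵥ (m - x)) := by
  obtain ⟨B, hB⟩ : ∃ B : Matrix (Fin q) (Fin q) ℝ, P = Bᵀ * B := by
    open scoped MatrixOrder in
    obtain ⟨B, hB⟩ := CStarAlgebra.nonneg_iff_eq_star_mul_self.mp hP.posSemidef.nonneg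
    exact ⟨B, by simpa [star_eq_conjTranspose] using hB⟩
  have hdet : P.det = B.det ^ 2 := by rw [hB]; simp [sq]
  have hB0 : B.det ≠ 0 := by
    intro h; have := hP.det_pos; rw [hdet, h] at this; simp at this
  have hQ : ∀ u, u ⬝ᵥ P *ᵥ u = (B *ᵥ u) ⬝ᵥ (B *ᵥ u) := by
    intro u
    rw [hB, ← mulVec_mulVec, dotProduct_mulVec, vecMul_transpose]
  have hs : √P.det = |B.det| := by rw [hdet, Real.sqrt_sq_eq_abs]
  obtain ⟨i1, i2, e1, e2⟩ := stdD q a (B *ᵥ (m - x)) ha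
  have c1 := cov q B hB0 _ x i1
  have c2 := cov q B hB0 _ x i2
  have hsub : ∀ μ, B *ᵥ (μ - x) - B *ᵥ (m - x) = B *ᵥ (μ - m) := by
    intro μ; rw [← mulVec_sub]; congr 1; abel
  rw [e1] at c1
  rw [e2] at c2
  simp_rw [hsub] at c1 c2
  simp_rw [hQ, hs]
  exact ⟨c1.1, c2.1, c1.2, by rw [c2.2]; ring⟩

/-- Theorem 2 of the paper: for the posterior `MVN(x̄, Σ/n)` and the Gaussian-kernel
weight with precision `n^κ·Σ⁻¹` centered at `γ`, the information gain equals
`(q/2)·n^κ/(n^κ+n) − (1/2)(γ−x̄)ᵀΣ⁻¹(γ−x̄)·(n^(κ+1/2)/(n^κ+n))²`. -/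
theorem multivariate_information_gain_closed_form
    (q : ℕ) (hq : 1 ≤ q) (n : ℕ) (hn : 1 ≤ n) (κ : ℝ)
    (S : Matrix (Fin q) (Fin q) ℝ) (hS : S.PosDef)
    (γ xb : Fin q → ℝ)
    (f : (Fin q → ℝ) → ℝ)
    (hf : ∀ μ : Fin q → ℝ, f μ =
      (2 * Real.pi) ^ (-(q : ℝ) / 2) * ((n : ℝ)⁻¹ • S).det ^ (-(1 / 2) : ℝ)
        * Real.exp (-((n : ℝ) / 2) * ((xb - μ) ⬝ᵥ S⁻¹.mulVec (xb - μ))))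
    (C : ℝ) (hC : 0 < C)
    (w : (Fin q → ℝ) → ℝ)
    (hw : ∀ μ : Fin q → ℝ, w μ =
      C * Real.exp (-((n : ℝ) ^ κ / 2) * ((μ - γ) ⬝ᵥ S⁻¹.mulVec (μ - γ))))
    (hnorm : ∫ μ : Fin q → ℝ, w μ * f μ = 1) :
    (-∫ μ : Fin q → ℝ, f μ * Real.log (f μ))
      - (-∫ μ : Fin q → ℝ, w μ * f μ * Real.log (f μ))
      = (q : ℝ) / 2 * (n : ℝ) ^ κ / ((n : ℝ) ^ κ + n)
        - 1 / 2 * ((γ - xb) ⬝ᵥ S⁻¹.mulVec (γ - xb))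
          * ((n : ℝ) ^ (κ + 1 / 2) / ((n : ℝ) ^ κ + n)) ^ 2 := by
  have hN : (0:ℝ) < n := by exact_mod_cast hn
  have hk : (0:ℝ) < (n:ℝ) ^ κ := Real.rpow_pos_of_pos hN κ
  have hpow : ((n:ℝ) ^ (κ + 1/2)) ^ 2 = ((n:ℝ) ^ κ) ^ 2 * n := by
    rw [Real.rpow_add hN, mul_pow, ← Real.sqrt_eq_rpow, Real.sq_sqrt hN.le]
  rw [div_pow, hpow]
  have hP : (S⁻¹).PosDef := hS.inv
  have hA1 : 0 < ((n : ℝ)⁻¹ • S).det := by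
    rw [det_smul]; have := hS.det_pos; positivity
  have hAZ : ((2 * Real.pi) ^ (-(q : ℝ) / 2) * ((n : ℝ)⁻¹ • S).det ^ (-(1 / 2) : ℝ))
      * ((√(S⁻¹).det)⁻¹ * √(2 * Real.pi / n) ^ q) = 1 := by
    have hd := hS.det_pos
    have h1 : (2 * Real.pi) ^ (-(q : ℝ) / 2) = (√(2 * Real.pi) ^ q)⁻¹ := by
      rw [Real.sqrt_eq_rpow, ← Real.rpow_natCast, ← Real.rpow_mul (by positivity),
        ← Real.rpow_neg (by positivity)]
      congr 1; ring
    have h2 : ((n : ℝ)⁻¹ • S).det ^ (-(1 / 2) : ℝ) = √(n:ℝ) ^ q * (√S.det)⁻¹ := by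
      rw [Real.rpow_neg hA1.le, ← Real.sqrt_eq_rpow, det_smul, Fintype.card_fin,
        Real.sqrt_mul (by positivity), mul_inv, inv_pow, Real.sqrt_inv, inv_inv]
      congr 1
      rw [Real.sqrt_eq_rpow, Real.sqrt_eq_rpow, ← Real.rpow_natCast, ← Real.rpow_natCast,
        ← Real.rpow_mul hN.le, ← Real.rpow_mul hN.le, mul_comm]
    have h3 : (S⁻¹).det = (S.det)⁻¹ := by
      rw [det_nonsing_inv, Ring.inverse_eq_inv']
    rw [h1, h2, h3, Real.sqrt_inv, inv_inv, Real.sqrt_div (by positivity), div_pow]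
    have e1 : √S.det ≠ 0 := by positivity
    have e2 : √(n:ℝ) ≠ 0 := by positivity
    have e3 : √(2 * Real.pi) ≠ 0 := by positivity
    field_simp
  have hApos : 0 < (2 * Real.pi) ^ (-(q : ℝ) / 2) * ((n : ℝ)⁻¹ • S).det ^ (-(1 / 2) : ℝ) := by
    positivity
  generalize (2 * Real.pi) ^ (-(q : ℝ) / 2) * ((n : ℝ)⁻¹ • S).det ^ (-(1 / 2) : ℝ) = A at *
  generalize (n:ℝ) ^ κ = k at *
  generalize S⁻¹ = P at *
  generalize (n:ℝ) = N at *
  have hsym : ∀ u v, u ⬝ᵥ P *ᵥ v = v ⬝ᵥ P *ᵥ u := by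
    intro u v
    have hT : Pᵀ = P := by simpa using hP.isHermitian.eq
    rw [dotProduct_comm, ← vecMul_transpose, hT, ← dotProduct_mulVec]
  have hflip : ∀ μ, (xb - μ) ⬝ᵥ P *ᵥ (xb - μ) = (μ - xb) ⬝ᵥ P *ᵥ (μ - xb) := by
    intro μ
    rw [← neg_sub μ xb, mulVec_neg, neg_dotProduct, dotProduct_neg, neg_neg]
  simp only [hflip] at hf
  have ha : 0 < k + N := by positivity
  set m : Fin q → ℝ := xb + (k / (k + N)) • (γ - xb) with hm
  have hmx : (m - xb) ⬝ᵥ P *ᵥ (m - xb) = (k / (k + N)) ^ 2 * ((γ - xb) ⬝ᵥ P *ᵥ (γ - xb)) := by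
    rw [hm, add_sub_cancel_left, mulVec_smul, smul_dotProduct, dotProduct_smul]
    simp only [smul_eq_mul]; ring
  have hcs : ∀ μ, k * ((μ - γ) ⬝ᵥ P *ᵥ (μ - γ)) + N * ((μ - xb) ⬝ᵥ P *ᵥ (μ - xb))
      = (k + N) * ((μ - m) ⬝ᵥ P *ᵥ (μ - m)) + k * N / (k + N) * ((γ - xb) ⬝ᵥ P *ᵥ (γ - xb)) := by
    intro μ
    have g1 : μ - γ = (μ - xb) - (γ - xb) := by abel
    have g2 : μ - m = (μ - xb) - (k / (k + N)) • (γ - xb) := by rw [hm]; abel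
    rw [g1, g2]
    generalize μ - xb = u
    generalize γ - xb = e
    simp only [mulVec_sub, mulVec_smul, sub_dotProduct, dotProduct_sub, smul_dotProduct,
      dotProduct_smul, smul_eq_mul, hsym e u]
    field_simp
    ring
  obtain ⟨i1, i2, e1, e2⟩ := gaussP q P hP N hN xb xb
  obtain ⟨j1, j2, s1, s2⟩ := gaussP q P hP (k + N) ha m xb
  have hlog : ∀ μ, Real.log (f μ) = Real.log A - N / 2 * ((μ - xb) ⬝ᵥ P *ᵥ (μ - xb)) := by
    intro μ
    rw [hf, Real.log_mul hApos.ne' (Real.exp_ne_zero _), Real.log_exp]; ring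
  set K : ℝ := C * A * Real.exp (-(k * N / (k + N) * ((γ - xb) ⬝ᵥ P *ᵥ (γ - xb))) / 2) with hK
  have hwf : ∀ μ, w μ * f μ = K * Real.exp (-((k + N)/2) * ((μ - m) ⬝ᵥ P *ᵥ (μ - m))) := by
    intro μ
    rw [hw, hf, hK]
    have : Real.exp (-(k / 2) * ((μ - γ) ⬝ᵥ P *ᵥ (μ - γ)))
        * Real.exp (-(N / 2) * ((μ - xb) ⬝ᵥ P *ᵥ (μ - xb)))
        = Real.exp (-(k * N / (k + N) * ((γ - xb) ⬝ᵥ P *ᵥ (γ - xb))) / 2)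
        * Real.exp (-((k + N)/2) * ((μ - m) ⬝ᵥ P *ᵥ (μ - m))) := by
      rw [← Real.exp_add, ← Real.exp_add]
      congr 1
      linarith [hcs μ]
    linear_combination C * A * this
  have hI1 : ∫ μ, f μ * Real.log (f μ) = Real.log A - N / 2 * (q / N) := by
    have : ∀ μ, f μ * Real.log (f μ)
        = A * Real.log A * Real.exp (-(N/2) * ((μ - xb) ⬝ᵥ P *ᵥ (μ - xb)))
        - A * (N / 2) * (Real.exp (-(N/2) * ((μ - xb) ⬝ᵥ P *ᵥ (μ - xb)))
          * ((μ - xb) ⬝ᵥ P *ᵥ (μ - xb))) := by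
      intro μ; rw [hlog, hf]; ring
    simp_rw [this]
    rw [integral_sub (i1.const_mul _) (i2.const_mul _), integral_const_mul, integral_const_mul,
      e1, e2, sub_self, zero_dotProduct, add_zero]
    linear_combination (Real.log A - N / 2 * (q / N)) * hAZ
  simp_rw [hwf] at hnorm
  rw [integral_const_mul, s1] at hnorm
  have hI2 : ∫ μ, w μ * f μ * Real.log (f μ) = Real.log A - N / 2 * (q / (k + N)
      + (k / (k + N)) ^ 2 * ((γ - xb) ⬝ᵥ P *ᵥ (γ - xb))) := by
    have : ∀ μ, w μ * f μ * Real.log (f μ)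
        = K * Real.log A * Real.exp (-((k + N)/2) * ((μ - m) ⬝ᵥ P *ᵥ (μ - m)))
        - K * (N / 2) * (Real.exp (-((k + N)/2) * ((μ - m) ⬝ᵥ P *ᵥ (μ - m)))
          * ((μ - xb) ⬝ᵥ P *ᵥ (μ - xb))) := by
      intro μ; rw [hlog, hwf]; ring
    simp_rw [this]
    rw [integral_sub (j1.const_mul _) (j2.const_mul _), integral_const_mul, integral_const_mul,
      s1, s2, hmx]
    linear_combination (Real.log A - N / 2 * (q / (k + N)
      + (k / (k + N)) ^ 2 * ((γ - xb) ⬝ᵥ P *ᵥ (γ - xb)))) * hnorm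
  rw [hI1, hI2]
  field_simp
  ring
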